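/- In the marked-context SKI calculus, the marker R never moves into the right-hand argument of an application: if t is a term in which R does not appear, then every term reachable from R t by reduction and structural congruence has the property that the right-hand argument of every application occurring in it is R-free. -/

import Mathlib

/-- Terms of the SKI calculus extended with a reduction-context marker `R`. -/
inductive Tm : Type
  | S : Tm
  | K : Tm
  | I : Tm
  | R : Tm → Tm
  | app : Tm → Tm → Tm
deriving DecidableEq

namespace Tm

/-- Structural congruence: the smallest congruence generated by `R (x y) = ((R x) y)`. -/
inductive SC : Tm → Tm → Prop
  | rapp (x y : Tm) : SC (R (app x y)) (app (R x) y)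
  | refl (t : Tm) : SC t t
  | symm {a b : Tm} : SC a b → SC b a
  | trans {a b c : Tm} : SC a b → SC b c → SC a c
  | congR {a b : Tm} : SC a b → SC (R a) (R b)
  | congApp {a b c d : Tm} : SC a b → SC c d → SC (app a c) (app b d)

/-- One-step reduction of the marked-context SKI calculus: the smallest relation
closed under structural congruence containing the rewrites σ, κ, ι
(reduction happens only at marked contexts). -/
inductive StepM : Tm → Tm → Prop
  | sigma (x y z : Tm) :
      StepM (app (app (app (R S) x) y) z) (app (app (R x) z) (app y z))
  | kappa (y z : Tm) : StepM (app (app (R K) y) z) (R y)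
  | iota (z : Tm) : StepM (app (R I) z) (R z)
  | struct {a a' b b' : Tm} : SC a a' → StepM a' b' → SC b' b → StepM a b

/-- One-step reduction of the gas SKI calculus: the marker `R` is consumed by each rewrite. -/
inductive StepG : Tm → Tm → Prop
  | sigma (x y z : Tm) :
      StepG (app (app (app (R S) x) y) z) (app (app x z) (app y z))
  | kappa (y z : Tm) : StepG (app (app (R K) y) z) y
  | iota (z : Tm) : StepG (app (R I) z) z
  | struct {a a' b b' : Tm} : SC a a' → StepG a' b' → SC b' b → StepG a b

/-- A term is `R`-free when the marker `R` does not appear in it. -/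
def RFree : Tm → Prop
  | R _ => False
  | app a b => RFree a ∧ RFree b
  | _ => True

/-- Weak head reduction of ordinary (R-free) SKI terms: the leftmost combinator is
reduced whenever it is applied to sufficiently many arguments. -/
inductive Head : Tm → Tm → Prop
  | sigma (x y z : Tm) :
      Head (app (app (app S x) y) z) (app (app x z) (app y z))
  | kappa (y z : Tm) : Head (app (app K y) z) y
  | iota (z : Tm) : Head (app I z) z
  | left {a a' : Tm} (b : Tm) : Head a a' → Head (app a b) (app a' b)

/-- `IsWhnf t t'` : `t'` is the weak head normal form of `t`. -/
def IsWhnf (t t' : Tm) : Prop :=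
  Relation.ReflTransGen Head t t' ∧ ∀ u, ¬ Head t' u

/-- The number of occurrences of the marker `R` in a term. -/
def countR : Tm → ℕ
  | R t => countR t + 1
  | app a b => countR a + countR b
  | _ => 0

/-- `StepsN step n a b` : `a` reduces to `b` in exactly `n` steps of `step`. -/
inductive StepsN (step : Tm → Tm → Prop) : ℕ → Tm → Tm → Prop
  | refl (t : Tm) : StepsN step 0 t t
  | tail {n : ℕ} {a b c : Tm} : StepsN step n a b → step b c → StepsN step (n + 1) a c

/-- `Rn n t` is the `n`-fold application of `R` to `t`. -/
def Rn : ℕ → Tm → Tm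
  | 0, t => t
  | n + 1, t => R (Rn n t)

/-- The σ, κ, ι redexes of the gas SKI calculus with `R`-free arguments. -/
inductive GasRedex : Tm → Tm → Prop
  | sigma {x y z : Tm} : RFree x → RFree y → RFree z →
      GasRedex (app (app (app (R S) x) y) z) (app (app x z) (app y z))
  | kappa {y z : Tm} : RFree y → RFree z → GasRedex (app (app (R K) y) z) y
  | iota {z : Tm} : RFree z → GasRedex (app (R I) z) z

/-- The right-hand argument of every application occurring in the term is `R`-free. -/
def RightArgsRFree : Tm → Prop
  | R t => RightArgsRFree t
  | app a b => RightArgsRFree a ∧ RightArgsRFree b ∧ RFree b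
  | _ => True

end Tm

theorem Tm.SC.pres {a b : Tm} (h : Tm.SC a b) :
    (Tm.RFree a ↔ Tm.RFree b) ∧ (Tm.RightArgsRFree a ↔ Tm.RightArgsRFree b) := by
  induction h <;> simp_all [Tm.RFree, Tm.RightArgsRFree]

theorem Tm.RFree.right {a : Tm} (h : Tm.RFree a) : Tm.RightArgsRFree a := by
  induction a <;> simp_all [Tm.RFree, Tm.RightArgsRFree]

theorem Tm.StepM.pres {a b : Tm} (h : Tm.StepM a b) :
    Tm.RightArgsRFree a → Tm.RightArgsRFree b := by
  induction h with
  | struct h1 _ h3 ih => exact fun h => h3.pres.2.1 (ih (h1.pres.2.1 h))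
  | _ => simp_all [Tm.RFree, Tm.RightArgsRFree]

/-- in the marked-context SKI calculus, starting from `R t` with `t`
`R`-free, every term reachable by reduction and structural congruence has the
property that the right-hand argument of every application occurring in it is `R`-free. -/
theorem stmt4 (t u : Tm) (ht : Tm.RFree t)
    (hreach : Relation.ReflTransGen (fun a b => Tm.StepM a b ∨ Tm.SC a b) (Tm.R t) u) :
    Tm.RightArgsRFree u := by
  induction hreach with
  | refl => exact ht.right
  | tail _ h ih =>
    rcases h with h | h
    · exact h.pres ih
    · exact h.pres.2.1 ih
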